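/- All solutions (n, r, x) in nonnegative integers n, r with x a positive integer of the Diophantine equation F_n^x = L_r are (n,r,x) = (1,1,x) and (2,1,x) for arbitrary x ≥ 1, together with (3,3,2), (3,0,1), and (4,2,1). -/

import Mathlib

/-- The Lucas sequence: `L 0 = 2`, `L 1 = 1`, `L (n+2) = L (n+1) + L n`. -/
def lucas : ℕ → ℕ
  | 0 => 2
  | 1 => 1
  | n + 2 => lucas (n + 1) + lucas n

theorem lucas_add_two (n : ℕ) : lucas (n + 2) = lucas (n + 1) + lucas n := rfl

theorem lucas_pos (n : ℕ) : 0 < lucas n := by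
  induction n using Nat.twoStepInduction with
  | zero => decide
  | one => decide
  | more n h _ => rw [lucas_add_two]; omega

theorem le_lucas (n : ℕ) : n ≤ lucas n := by
  induction n using Nat.twoStepInduction with
  | zero => decide
  | one => decide
  | more n _ h => have := lucas_pos n; rw [lucas_add_two]; omega

theorem lucas_succ_eq_fib_add_fib (n : ℕ) :
    lucas (n + 1) = Nat.fib n + Nat.fib (n + 2) := by
  induction n using Nat.twoStepInduction with
  | zero => decide
  | one => decide
  | more n h h' =>
    rw [lucas_add_two, h, h', Nat.fib_add_two (n := n), Nat.fib_add_two (n := n + 2),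
      Nat.fib_add_two (n := n + 1), Nat.fib_add_two (n := n)]
    ring

theorem lucas_add (m k : ℕ) :
    lucas (m + 1 + k) = Nat.fib (m + 1) * lucas (k + 1) + Nat.fib m * lucas k := by
  induction k using Nat.twoStepInduction with
  | zero =>
    cases m with
    | zero => decide
    | succ m =>
      have h := Nat.fib_add_two (n := m)
      have h' := Nat.fib_add_two (n := m + 1)
      have h0 : lucas 0 = 2 := rfl
      have h1 : lucas 1 = 1 := rfl
      rw [add_zero, lucas_succ_eq_fib_add_fib, h0, zero_add, h1]
      grind
  | one =>
    have h := Nat.fib_add_two (n := m)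
    have h' := Nat.fib_add_two (n := m + 1)
    have h1 : lucas 1 = 1 := rfl
    have h2 : lucas 2 = 3 := rfl
    rw [lucas_succ_eq_fib_add_fib, h1, h2]
    grind
  | more k h h' =>
    rw [lucas_add_two (k + 1), ← add_assoc, lucas_add_two (m + 1 + k), add_assoc _ k 1, h', h,
      lucas_add_two k]
    ring

theorem fib_dvd_lucas_mod {n r : ℕ} (hn : 0 < n) (h : Nat.fib n ∣ lucas r) :
    Nat.fib n ∣ lucas (r % n) := by
  induction r using Nat.strong_induction_on with
  | _ r ih =>
    rcases lt_or_ge r n with hr | hr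
    · rwa [Nat.mod_eq_of_lt hr]
    · obtain ⟨k, rfl⟩ := Nat.exists_eq_add_of_le hr
      rw [Nat.add_mod_left]
      apply ih k (by omega)
      obtain ⟨m, rfl⟩ := Nat.exists_eq_add_of_lt hn
      rw [zero_add, lucas_add, Nat.dvd_add_right (dvd_mul_right _ _)] at h
      rw [zero_add]
      exact (Nat.fib_coprime_fib_succ m).symm.dvd_of_dvd_mul_left h

theorem lucas_lt_fib {k n : ℕ} (hn : 5 ≤ n) (hk : k + 2 ≤ n) : lucas k < Nat.fib n := by
  rcases lt_or_ge k 3 with h | h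
  · have h5 : Nat.fib 5 ≤ Nat.fib n := Nat.fib_mono hn
    have : lucas k < Nat.fib 5 := by interval_cases k <;> decide
    omega
  · obtain ⟨k, rfl⟩ := Nat.exists_eq_add_of_le' h
    have h1 : Nat.fib (k + 5) ≤ Nat.fib n := Nat.fib_mono hk
    have h2 : Nat.fib (k + 2) < Nat.fib (k + 3) := Nat.fib_lt_fib_succ (by omega)
    have h3 : lucas (k + 3) = Nat.fib (k + 2) + Nat.fib (k + 4) :=
      lucas_succ_eq_fib_add_fib (k + 2)
    have h4 : Nat.fib (k + 5) = Nat.fib (k + 3) + Nat.fib (k + 4) := Nat.fib_add_two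
    omega

theorem not_fib_dvd_lucas {n : ℕ} (hn : 5 ≤ n) (r : ℕ) : ¬ Nat.fib n ∣ lucas r := by
  intro h
  replace h := fib_dvd_lucas_mod (by omega) h
  have hr := Nat.mod_lt r (show 0 < n by omega)
  rcases Nat.lt_or_ge n (r % n + 2) with hk | hk
  · obtain ⟨m, rfl⟩ := Nat.exists_eq_add_of_le' hn
    rw [show r % (m + 5) = m + 3 + 1 by omega, lucas_succ_eq_fib_add_fib,
      Nat.dvd_add_left dvd_rfl] at h
    exact Nat.not_dvd_of_pos_of_lt (Nat.fib_pos.2 (by omega))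
      ((Nat.fib_lt_fib_succ (by omega)).trans_le (Nat.fib_le_fib_succ)) h
  · exact Nat.not_dvd_of_pos_of_lt (lucas_pos _) (lucas_lt_fib hn hk) h

theorem not_eight_dvd_lucas (r : ℕ) : ¬ 8 ∣ lucas r := by
  induction r using Nat.strong_induction_on with
  | _ r ih =>
    rcases lt_or_ge r 12 with hr | hr
    · interval_cases r <;> decide
    · obtain ⟨k, rfl⟩ := Nat.exists_eq_add_of_le hr
      have h := ih k (by omega)
      have h' : lucas (12 + k) = 144 * lucas (k + 1) + 89 * lucas k := lucas_add 11 k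
      omega

theorem two_dvd_lucas_of_nine_dvd {r : ℕ} (h : 9 ∣ lucas r) : 2 ∣ lucas r := by
  induction r using Nat.strong_induction_on with
  | _ r ih =>
    rcases lt_or_ge r 24 with hr | hr
    · interval_cases r <;> revert h <;> simp [lucas]
    · obtain ⟨k, rfl⟩ := Nat.exists_eq_add_of_le hr
      have h' : lucas (24 + k) = 46368 * lucas (k + 1) + 28657 * lucas k := by
        have := lucas_add 23 k
        norm_num [Nat.fib_add_two] at this
        exact this
      have := ih k (by omega) (by omega)
      omega

theorem lucas_eq_one_iff {r : ℕ} : lucas r = 1 ↔ r = 1 := by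
  refine ⟨fun h => ?_, by rintro rfl; rfl⟩
  have hr := le_lucas r
  rw [h] at hr
  interval_cases r <;> revert h <;> decide

theorem two_pow_eq_lucas {r x : ℕ} (hx : 0 < x) (h : 2 ^ x = lucas r) :
    (r = 3 ∧ x = 2) ∨ (r = 0 ∧ x = 1) := by
  have hx3 : x < 3 := by
    by_contra! hx3
    exact not_eight_dvd_lucas r (h ▸ pow_dvd_pow 2 hx3)
  have hr := le_lucas r
  rw [← h] at hr
  interval_cases x <;> norm_num at hr <;> interval_cases r <;> revert h <;> decide

theorem three_pow_eq_lucas {r x : ℕ} (hx : 0 < x) (h : 3 ^ x = lucas r) : r = 2 ∧ x = 1 := by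
  have hx2 : x < 2 := by
    by_contra! hx2
    have h2 : 2 ∣ 3 ^ x := h ▸ two_dvd_lucas_of_nine_dvd (h ▸ pow_dvd_pow 3 hx2)
    exact absurd (Nat.prime_two.dvd_of_dvd_pow h2) (by decide)
  have hr := le_lucas r
  rw [← h] at hr
  interval_cases x
  norm_num at hr
  interval_cases r <;> revert h <;> decide

theorem fib_pow_eq_lucas (n r x : ℕ) (hx : 0 < x) :
    Nat.fib n ^ x = lucas r ↔
      ((n, r) = (1, 1) ∨ (n, r) = (2, 1) ∨
        (n, r, x) ∈ ({(3, 3, 2), (3, 0, 1), (4, 2, 1)} : Set (ℕ × ℕ × ℕ))) := by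
  simp only [Set.mem_insert_iff, Set.mem_singleton_iff, Prod.mk.injEq]
  constructor
  · intro h
    have hn : n < 5 := by
      by_contra! hn
      exact not_fib_dvd_lucas hn r (h ▸ dvd_pow_self _ hx.ne')
    interval_cases n
    · rw [Nat.fib_zero, zero_pow hx.ne'] at h
      exact absurd h (lucas_pos r).ne
    · rw [Nat.fib_one, one_pow] at h
      simp [lucas_eq_one_iff.1 h.symm]
    · rw [Nat.fib_two, one_pow] at h
      simp [lucas_eq_one_iff.1 h.symm]
    · have := two_pow_eq_lucas hx h
      omega
    · have := three_pow_eq_lucas hx h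
      omega
  · rintro (⟨rfl, rfl⟩ | ⟨rfl, rfl⟩ | ⟨rfl, rfl, rfl⟩ | ⟨rfl, rfl, rfl⟩ | ⟨rfl, rfl, rfl⟩) <;>
      simp [lucas, Nat.fib_add_two]
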